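/- Suppose a degree parameter sequence {d_n}, d_n∈{1,2,…}^n, satisfies: there exist β>0 and ε>0 such that for r=4β+2 and r=4β+2+ε, the sequence L_{n,r}=n^{-1}Σ_{u∈N}(d_n(u)/λ_n)^r is bounded away from zero and infinity, where λ_n is the average entry of d_n. For each n let B_n be a uniformly random subset of N={1,…,n} of size b_n, with b_n→∞. Choose δ∈(0,1) with 2βδ<ε. Then for every r∈(0, β(2+δ)+1] there exists an interval I_r=(a_r,b_r) with 0<a_r<b_r<∞ such that P(L_{n,r}(B_n)∈I_r) → 1 as n→∞, where L_{n,r}(B)=|B|^{-1}Σ_{u∈B}(d_n(u)/λ_n)^r. -/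

import Mathlib

open MeasureTheory Filter Finset
open scoped ENNReal Classical

/-- A real sequence is bounded away from zero and infinity. -/
def BddAwayFromZeroAndInfty (a : ℕ → ℝ) : Prop :=
  ∃ c₁ c₂ : ℝ, 0 < c₁ ∧ ∀ᶠ n in atTop, c₁ ≤ a n ∧ a n ≤ c₂

/-- The average entry `λ_n` of the degree vector `d_n` (on `n+1` nodes). -/
noncomputable def lamAvg (d : ∀ n : ℕ, Fin (n + 1) → ℕ) (n : ℕ) : ℝ :=
  (∑ u, (d n u : ℝ)) / (n + 1)

/-- `L_{n,r}(B) = |B|⁻¹ Σ_{u∈B} (d_n(u)/λ_n)^r`. -/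
noncomputable def Lmom (d : ∀ n : ℕ, Fin (n + 1) → ℕ) (n : ℕ) (r : ℝ)
    (B : Finset (Fin (n + 1))) : ℝ :=
  (B.card : ℝ)⁻¹ * ∑ u ∈ B, ((d n u : ℝ) / lamAvg d n) ^ r

lemma aux_p (n b : ℕ) (hb : 2 ≤ b) (u v : Fin (n+1)) :
    ((((univ : Finset (Fin (n+1))).powersetCard b).filter (fun S => u ∈ S ∧ v ∈ S)).card : ℝ)
      = (Nat.choose (n-1) (b-2) : ℝ) +
        if u = v then (Nat.choose n (b-1) : ℝ) - (Nat.choose (n-1) (b-2) : ℝ) else 0 := by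
  have h := card_filter_powersetCard_subset ({u, v} : Finset (Fin (n+1))) univ b (subset_univ _)
    (le_trans (card_le_two) hb)
  have e : ((univ : Finset (Fin (n+1))).powersetCard b).filter (fun S => u ∈ S ∧ v ∈ S) =
      ((univ : Finset (Fin (n+1))).powersetCard b).filter (({u, v} : Finset (Fin (n+1))) ⊆ ·) := by
    ext S; simp [insert_subset_iff]
  rw [e, h]
  split_ifs with huv
  · subst huv; simp
  · rw [card_pair huv]; simp

lemma aux_var (n b : ℕ) (hb : 2 ≤ b) (y : Fin (n+1) → ℝ) (hy : ∑ u, y u = 0) :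
    ((n:ℝ)+1) * ∑ S ∈ (univ : Finset (Fin (n+1))).powersetCard b, (∑ u ∈ S, y u)^2
      ≤ b * (Nat.choose (n+1) b) * ∑ u, y u ^ 2 := by
  have h1 : ∀ S : Finset (Fin (n+1)), (∑ u ∈ S, y u)^2
      = ∑ u, ∑ v, if u ∈ S ∧ v ∈ S then y u * y v else 0 := by
    intro S
    rw [sq, sum_mul_sum]
    simp only [ite_and]
    simp [sum_ite_mem]
  have h2 : ∑ S ∈ (univ : Finset (Fin (n+1))).powersetCard b, (∑ u ∈ S, y u)^2
      = ((Nat.choose n (b-1) : ℝ) - (Nat.choose (n-1) (b-2) : ℝ)) * ∑ u, y u ^ 2 := by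
    simp_rw [h1]
    rw [sum_comm]
    have h3 : ∀ u, ∑ S ∈ (univ : Finset (Fin (n+1))).powersetCard b,
        ∑ v, (if u ∈ S ∧ v ∈ S then y u * y v else 0) =
        ((Nat.choose n (b-1) : ℝ) - (Nat.choose (n-1) (b-2) : ℝ)) * y u ^ 2 := by
      intro u
      rw [sum_comm]
      have h4 : ∀ v, ∑ S ∈ (univ : Finset (Fin (n+1))).powersetCard b,
          (if u ∈ S ∧ v ∈ S then y u * y v else 0) = (Nat.choose (n-1) (b-2) : ℝ) * y u * y v +
          if u = v then ((Nat.choose n (b-1) : ℝ) - (Nat.choose (n-1) (b-2) : ℝ)) * y u * y v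
            else 0 := by
        intro v
        rw [← sum_filter, sum_const, nsmul_eq_mul, aux_p n b hb u v]
        split_ifs <;> ring
      simp_rw [h4]
      rw [sum_add_distrib, ← mul_sum, hy]
      simp
      ring
    simp_rw [h3, ← mul_sum]
  have h5 : ((n:ℝ)+1) * (Nat.choose n (b-1) : ℝ) = b * (Nat.choose (n+1) b) := by
    have := Nat.add_one_mul_choose_eq n (b-1)
    rw [show b - 1 + 1 = b by omega] at this
    have h : ((n+1:ℕ):ℝ) * (Nat.choose n (b-1) : ℝ) = (Nat.choose (n+1) b) * b := by exact_mod_cast this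
    push_cast at h
    linarith
  rw [h2, ← h5, ← mul_assoc]
  have : 0 ≤ ∑ u, y u ^ 2 := sum_nonneg (fun _ _ => sq_nonneg _)
  gcongr
  have : (0:ℝ) ≤ (Nat.choose (n-1) (b-2) : ℝ) := by positivity
  linarith

lemma aux_count (n b : ℕ) (hb : 2 ≤ b) (X : Fin (n+1) → ℝ) (m Q η : ℝ) (hη : 0 < η)
    (hm : ∑ u, X u = (n+1) * m) (hQ : ∑ u, X u ^ 2 ≤ (n+1) * Q) :
    ((((univ : Finset (Fin (n+1))).powersetCard b).filter
      (fun S => η ≤ |(b:ℝ)⁻¹ * ∑ u ∈ S, X u - m|)).card : ℝ)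
      ≤ Q / (b * η^2) * Nat.choose (n+1) b := by
  have hb0 : (0:ℝ) < b := by positivity
  have hv := aux_var n b hb (fun u => X u - m) (by simp [hm])
  have hq : ∑ u, (X u - m)^2 ≤ (n+1) * Q := by
    have : ∑ u, (X u - m)^2 = ∑ u, X u ^2 - (n+1) * m^2 := by
      simp_rw [sub_sq]
      rw [sum_add_distrib, sum_sub_distrib]
      simp_rw [mul_assoc, ← mul_sum, ← sum_mul, hm]
      simp; ring
    rw [this]; nlinarith [sq_nonneg m, Nat.cast_nonneg (α := ℝ) n]
  set F := ((univ : Finset (Fin (n+1))).powersetCard b).filter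
      (fun S => η ≤ |(b:ℝ)⁻¹ * ∑ u ∈ S, X u - m|) with hF
  have hlow : (F.card : ℝ) * (b * η)^2 ≤
      ∑ S ∈ (univ : Finset (Fin (n+1))).powersetCard b, (∑ u ∈ S, (X u - m))^2 := by
    calc (F.card : ℝ) * (b * η)^2 = ∑ S ∈ F, (b * η)^2 := by simp
      _ ≤ ∑ S ∈ F, (∑ u ∈ S, (X u - m))^2 := by
        apply sum_le_sum
        intro S hS
        rw [hF, mem_filter, mem_powersetCard] at hS
        obtain ⟨⟨_, hc⟩, hS⟩ := hS
        have e : ∑ u ∈ S, (X u - m) = b * ((b:ℝ)⁻¹ * ∑ u ∈ S, X u - m) := by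
          rw [sum_sub_distrib, sum_const, hc, nsmul_eq_mul]; field_simp
        rw [e, mul_pow, mul_pow, ← sq_abs (_ - m)]
        gcongr
      _ ≤ _ := sum_le_sum_of_subset_of_nonneg (filter_subset _ _) (fun _ _ _ => sq_nonneg _)
  have hn : (0:ℝ) < (n:ℝ) + 1 := by positivity
  have hC : (0:ℝ) ≤ (b:ℝ) * (Nat.choose (n+1) b) := by positivity
  have h6 : ((n:ℝ)+1) * ((F.card : ℝ) * (b * η)^2) ≤ (n+1) * (b * (Nat.choose (n+1) b) * Q) := by
    calc _ ≤ _ := mul_le_mul_of_nonneg_left hlow hn.le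
      _ ≤ _ := hv
      _ ≤ _ := mul_le_mul_of_nonneg_left hq hC
      _ = _ := by ring
  have h7 := le_of_mul_le_mul_left h6 hn
  rw [div_mul_eq_mul_div, le_div_iff₀ (by positivity)]
  refine le_of_mul_le_mul_left ?_ hb0
  linarith

lemma aux_prob {Ω : Type} [MeasurableSpace Ω] (μ : Measure Ω) [IsProbabilityMeasure μ] (n b : ℕ)
    (hbn : b ≤ n + 1)
    (B : Ω → Finset (Fin (n + 1)))
    (hBmeas : ∀ (S0 : Finset (Fin (n + 1))), MeasurableSet {ω | B ω = S0})
    (hBcard : μ {ω | (B ω).card = b} = 1)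
    (hBunif : ∀ (S1 S2 : Finset (Fin (n + 1))), S1.card = b → S2.card = b →
      μ {ω | B ω = S1} = μ {ω | B ω = S2})
    (P : Finset (Fin (n+1)) → Prop) (p : ℝ)
    (hp : ((((univ : Finset (Fin (n+1))).powersetCard b).filter P).card : ℝ)
      ≤ p * Nat.choose (n+1) b) :
    ENNReal.ofReal (1 - p) ≤ μ {ω | ¬ P (B ω)} := by
  have hF : ∀ F : Finset (Finset (Fin (n+1))), μ.real {ω | B ω ∈ F} = ∑ S ∈ F, μ.real {ω | B ω = S} := by
    intro F
    have : {ω | B ω ∈ F} = ⋃ S ∈ F, {ω | B ω = S} := by ext; simp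
    rw [this, measureReal_biUnion_finset]
    · intro S _ T _ hST
      rw [Function.onFun, Set.disjoint_left]
      intro ω h1 h2
      exact hST (h1.symm.trans h2)
    · intro S _; exact hBmeas S
  obtain ⟨S0, hS0⟩ : ((univ : Finset (Fin (n+1))).powersetCard b).Nonempty := by
    rw [powersetCard_nonempty]; simpa using hbn
  rw [mem_powersetCard_univ] at hS0
  set q := μ.real {ω | B ω = S0} with hq
  have hFq : ∀ F ⊆ (univ : Finset (Fin (n+1))).powersetCard b,
      μ.real {ω | B ω ∈ F} = F.card * q := by
    intro F hsub
    rw [hF, sum_congr rfl (g := fun _ => q), sum_const, nsmul_eq_mul]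
    intro S hS
    have := hsub hS
    rw [mem_powersetCard_univ] at this
    simp only [hq, measureReal_def]
    rw [hBunif S S0 this hS0]
  have htot : 1 = (Nat.choose (n+1) b : ℝ) * q := by
    have := hFq _ (Subset.refl _)
    rw [card_powersetCard, card_univ, Fintype.card_fin] at this
    rw [← this]
    simp only [mem_powersetCard_univ, measureReal_def, hBcard]
    simp
  have hbad := hFq _ (filter_subset P ((univ : Finset (Fin (n+1))).powersetCard b))
  have hgood := hFq _ (filter_subset (fun S => ¬ P S) ((univ : Finset (Fin (n+1))).powersetCard b))
  have hsum := card_filter_add_card_filter_not (s := (univ : Finset (Fin (n+1))).powersetCard b) P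
  rw [card_powersetCard, card_univ, Fintype.card_fin] at hsum
  have hsum' : ((((univ : Finset (Fin (n+1))).powersetCard b).filter P).card : ℝ) +
     ((((univ : Finset (Fin (n+1))).powersetCard b).filter (fun S => ¬ P S)).card : ℝ)
      = (Nat.choose (n+1) b : ℝ) := by exact_mod_cast hsum
  have hq0 : 0 ≤ q := measureReal_nonneg
  calc ENNReal.ofReal (1 - p) ≤ ENNReal.ofReal (μ.real {ω | B ω ∈
        ((univ : Finset (Fin (n+1))).powersetCard b).filter (fun S => ¬ P S)}) := by
        apply ENNReal.ofReal_le_ofReal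
        rw [hgood]
        have e1 := mul_le_mul_of_nonneg_right hp hq0
        rw [mul_assoc, ← htot, mul_one] at e1
        have e2 := congrArg (fun z => z * q) hsum'
        simp only [add_mul] at e2
        rw [← htot] at e2
        linarith
    _ = μ {ω | B ω ∈
        ((univ : Finset (Fin (n+1))).powersetCard b).filter (fun S => ¬ P S)} := by
        rw [ofReal_measureReal]
    _ ≤ _ := by
        apply measure_mono
        intro ω hω
        simp only [Set.mem_ofPred_eq, mem_filter] at hω ⊢
        exact hω.2

lemma aux_pow1 (x r s : ℝ) (hx : 0 < x) (hr : 0 ≤ r) (hrs : r ≤ s) : x ^ r ≤ 1 + x ^ s := by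
  rcases le_total x 1 with h | h
  · have := Real.rpow_le_one hx.le h hr
    have := Real.rpow_pos_of_pos hx s
    linarith
  · have := Real.rpow_le_rpow_of_exponent_le h hrs
    linarith

lemma aux_pow2 (x r s T : ℝ) (hx : 0 < x) (hr : 0 < r) (hs : 2 ≤ s) (hT : 1 ≤ T) :
    x ≤ 1/4 + T * 4 ^ r * x ^ r + x ^ s / T := by
  have hT0 : 0 < T := by linarith
  have h1 : 0 ≤ T * 4 ^ r * x ^ r := by positivity
  have h2 : 0 ≤ x ^ s / T := by positivity
  rcases le_total x (1/4) with h | h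
  · linarith
  rcases le_total x T with h' | h'
  · have : 1 ≤ (4:ℝ) ^ r * x ^ r := by
      rw [← Real.mul_rpow (by norm_num) hx.le]
      exact Real.one_le_rpow (by linarith) hr.le
    nlinarith
  · have : x ^ 2 ≤ x ^ s := by
      rw [← Real.rpow_natCast]
      exact Real.rpow_le_rpow_of_exponent_le (by linarith) (by simpa using hs)
    have : x ≤ x ^ s / T := by
      rw [le_div_iff₀ hT0]; nlinarith
    linarith

/-- **Lemma 2.**  Suppose the degree sequence `{d_n}` satisfies
Assumption 2: there are `β, ε > 0` with `L_{n,r} = L_{n,r}(N)` bounded away from zero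
and infinity for `r = 4β+2` and `r = 4β+2+ε`.  For each `n` let `B_n` be a uniformly
random subset of the `n+1` nodes of size `b_n`, with `b_n → ∞`.  Choose `δ ∈ (0,1)`
with `2βδ < ε`.  Then for every `r ∈ (0, β(2+δ)+1]` there is an interval
`I_r = (a_r, b_r)`, `0 < a_r < b_r < ∞`, with `P(L_{n,r}(B_n) ∈ I_r) → 1`. -/
theorem uniform_subset_moment_concentration
    (β ε : ℝ) (hβ : 0 < β) (hε : 0 < ε)
    (d : ∀ n : ℕ, Fin (n + 1) → ℕ) (hd : ∀ n u, 1 ≤ d n u)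
    (hA2 : ∀ r : ℝ, r = 4 * β + 2 ∨ r = 4 * β + 2 + ε →
      BddAwayFromZeroAndInfty fun n => Lmom d n r univ)
    (b : ℕ → ℕ) (hble : ∀ n, b n ≤ n + 1)
    (hbtend : Tendsto (fun n => (b n : ℝ)) atTop atTop)
    (Ω : ℕ → Type) [∀ n, MeasurableSpace (Ω n)]
    (μ : ∀ n, Measure (Ω n)) [∀ n, IsProbabilityMeasure (μ n)]
    (B : ∀ n, Ω n → Finset (Fin (n + 1)))
    (hBmeas : ∀ n (S0 : Finset (Fin (n + 1))), MeasurableSet {ω | B n ω = S0})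
    -- `B_n` is uniform on the subsets of size `b_n`:
    (hBcard : ∀ n, μ n {ω | (B n ω).card = b n} = 1)
    (hBunif : ∀ n (S1 S2 : Finset (Fin (n + 1))), S1.card = b n → S2.card = b n →
      μ n {ω | B n ω = S1} = μ n {ω | B n ω = S2})
    (δ : ℝ) (hδ0 : 0 < δ) (hδ1 : δ < 1) (hδε : 2 * β * δ < ε) :
    ∀ r : ℝ, 0 < r → r ≤ β * (2 + δ) + 1 →
      ∃ ar br : ℝ, 0 < ar ∧ ar < br ∧
        Tendsto (fun n => μ n {ω | Lmom d n r (B n ω) ∈ Set.Ioo ar br})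
          atTop (nhds 1) := by
  intro r hr hr'
  set s := 4 * β + 2 + ε with hs
  have hs2 : 2 ≤ s := by linarith
  have h2r : 2 * r ≤ s := by nlinarith
  obtain ⟨c₁, c₂, hc₁, hev⟩ := hA2 s (Or.inr rfl)
  set T := max 1 (4 * c₂) with hT
  have hT1 : 1 ≤ T := le_max_left _ _
  have hT2 : 4 * c₂ ≤ T := le_max_right _ _
  have hT0 : 0 < T := by linarith
  set K := T * 4 ^ r with hK
  have hK0 : 0 < K := by positivity
  set c := 1 / (2 * K) with hc
  have hc0 : 0 < c := by positivity
  set C := 1 + c₂ with hC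
  have key : ∀ᶠ n in atTop, ENNReal.ofReal (1 - C / (b n * (c/2)^2)) ≤
      μ n {ω | Lmom d n r (B n ω) ∈ Set.Ioo (c/2) (max c C + c/2)} := by
    filter_upwards [hev, hbtend.eventually_ge_atTop 2] with n hn hbn
    have hb2 : 2 ≤ b n := by exact_mod_cast hbn
    have hn0 : (0:ℝ) < (n:ℝ) + 1 := by positivity
    have hsumd : 0 < ∑ u, (d n u : ℝ) :=
      sum_pos (fun u _ => by have := hd n u; positivity) univ_nonempty
    have hlam : 0 < lamAvg d n := by unfold lamAvg; positivity
    set x : Fin (n+1) → ℝ := fun u => (d n u : ℝ) / lamAvg d n with hxdef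
    have hx : ∀ u, 0 < x u := fun u => by
      have : (0:ℝ) < d n u := by exact_mod_cast hd n u
      simp only [hxdef]; positivity
    have hx1 : ∑ u, x u = n + 1 := by
      simp only [hxdef]
      rw [← sum_div]; unfold lamAvg; field_simp
    have hLs : ∑ u, x u ^ s ≤ (n+1) * c₂ := by
      have := hn.2
      simp only [Lmom, card_univ, Fintype.card_fin] at this
      push_cast at this
      rwa [inv_mul_le_iff₀ hn0] at this
    set m := ((n:ℝ)+1)⁻¹ * ∑ u, x u ^ r with hm
    have hm' : ∑ u, x u ^ r = (n+1) * m := by rw [hm]; field_simp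
    have hsum1 : ∀ t, 0 ≤ t → t ≤ s → ∑ u, x u ^ t ≤ (n+1) * C := by
      intro t ht hts
      calc ∑ u, x u ^ t ≤ ∑ u, (1 + x u ^ s) := sum_le_sum fun u _ => aux_pow1 _ _ _ (hx u) ht hts
        _ = (n + 1) + ∑ u, x u ^ s := by rw [sum_add_distrib]; simp
        _ ≤ _ := by rw [hC]; linarith
    have hmC : m ≤ C := by
      have := hsum1 r hr.le (by linarith)
      rw [hm'] at this
      exact le_of_mul_le_mul_left this hn0
    have hmc : c ≤ m := by
      have h : ∑ u, x u ≤ ∑ u, (1/4 + K * x u ^ r + x u ^ s / T) :=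
        sum_le_sum fun u _ => aux_pow2 _ _ _ _ (hx u) hr hs2 hT1
      rw [hx1, sum_add_distrib, sum_add_distrib, ← mul_sum, hm'] at h
      simp only [sum_const, card_univ, Fintype.card_fin, nsmul_eq_mul] at h
      push_cast at h
      have h3 : ∑ u, x u ^ s / T ≤ (n+1) * (1/4) := by
        rw [← sum_div, div_le_iff₀ hT0]; nlinarith
      have h4 : ((n:ℝ)+1) * (1/2) ≤ (n+1) * (K * m) := by linarith
      have h5 := le_of_mul_le_mul_left h4 hn0
      rw [hc, div_le_iff₀ (by positivity)]; linarith
    have hQ : ∑ u, (x u ^ r)^2 ≤ (n+1) * C := by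
      have := hsum1 (2*r) (by linarith) h2r
      convert this using 2 with u
      rw [← Real.rpow_natCast, ← Real.rpow_mul (hx u).le]; congr 1; push_cast; ring
    have hcount := aux_count n (b n) hb2 (fun u => x u ^ r) m C (c/2) (by positivity) hm' hQ
    have hpr := aux_prob (μ n) n (b n) (hble n) (B n) (hBmeas n) (hBcard n) (hBunif n) _ _ hcount
    refine hpr.trans ?_
    apply measure_mono_ae
    have hae : ∀ᵐ ω ∂(μ n), (B n ω).card = b n := by
      have hms : MeasurableSet {ω | (B n ω).card = b n} := by
        have : {ω | (B n ω).card = b n} =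
            ⋃ S ∈ (univ : Finset (Fin (n+1))).powersetCard (b n), {ω | B n ω = S} := by
          ext; simp
        rw [this]
        exact Finset.measurableSet_biUnion _ fun S _ => hBmeas n S
      exact (prob_compl_eq_zero_iff hms).2 (hBcard n)
    filter_upwards [hae] with ω hω hh
    change ¬ _ at hh
    change Lmom d n r (B n ω) ∈ Set.Ioo (c/2) (max c C + c/2)
    rw [not_le, abs_lt] at hh
    unfold Lmom
    rw [hω]
    have := le_max_right c C
    constructor <;> linarith [hh.1, hh.2]
  refine ⟨c/2, max c C + c/2, by positivity, by linarith [le_max_left c C], ?_⟩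
  refine tendsto_of_tendsto_of_tendsto_of_le_of_le' (g := fun n => ENNReal.ofReal (1 - C / (b n * (c/2)^2))) (h := fun _ => 1) ?_ tendsto_const_nhds key
    (Eventually.of_forall fun n => prob_le_one)
  rw [← ENNReal.ofReal_one]
  apply ENNReal.tendsto_ofReal
  have : Tendsto (fun n => C / ((b n : ℝ) * (c/2)^2)) atTop (nhds 0) :=
    Tendsto.const_div_atTop (hbtend.atTop_mul_const (by positivity)) _
  simpa using this.const_sub 1
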